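/- If A, B ∈ ℝ^{n×n} are premetrics, then im((A ⊙ B)*) = im((A ⊕ B)*) = im(A*) ∩ im(B*) as subsets of ℝⁿ. -/

import Mathlib

namespace TropComm

variable {n : ℕ}

/-- Tropical (min-plus) matrix product: `(A ⊙ B) i j = min_s (A i s + B s j)`. -/
def tropMul [NeZero n] (A B : Fin n → Fin n → ℝ) : Fin n → Fin n → ℝ :=
  fun i j => Finset.univ.inf' Finset.univ_nonempty (fun s => A i s + B s j)

/-- Tropical matrix-vector product: `(A ⊙ x) i = min_j (A i j + x j)`. -/
def tropMulVec [NeZero n] (A : Fin n → Fin n → ℝ) (x : Fin n → ℝ) : Fin n → ℝ :=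
  fun i => Finset.univ.inf' Finset.univ_nonempty (fun j => A i j + x j)

/-- Tropical sum: entrywise minimum. -/
def tropSum (A B : Fin n → Fin n → ℝ) : Fin n → Fin n → ℝ :=
  fun i j => min (A i j) (B i j)

/-- `tropPow A k` is the k-fold tropical product `A^{⊙k}` (with the junk value
`tropPow A 0 = A`; only exponents `k ≥ 1` are ever used). -/
def tropPow [NeZero n] (A : Fin n → Fin n → ℝ) : ℕ → (Fin n → Fin n → ℝ)
  | 0 => A
  | 1 => A
  | (k + 2) => tropMul A (tropPow A (k + 1))

/-- Kleene star `A* = A ⊕ A^{⊙2} ⊕ ⋯ ⊕ A^{⊙n}`. -/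
def kleene [NeZero n] (A : Fin n → Fin n → ℝ) : Fin n → Fin n → ℝ :=
  fun i j => Finset.univ.inf' Finset.univ_nonempty (fun k : Fin n => tropPow A (k.val + 1) i j)

/-- A premetric: zero diagonal, positive off-diagonal entries. -/
def IsPremetric (A : Fin n → Fin n → ℝ) : Prop :=
  (∀ i, A i i = 0) ∧ ∀ i j, i ≠ j → 0 < A i j

/-- A polytrope: a premetric satisfying the triangle inequality. -/
def IsPolytrope (A : Fin n → Fin n → ℝ) : Prop :=
  IsPremetric A ∧ ∀ i j k, A i j ≤ A i k + A k j


/-- The image of a matrix: `im(A) = {A ⊙ x : x ∈ ℝⁿ}`. -/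
def tropIm [NeZero n] (A : Fin n → Fin n → ℝ) : Set (Fin n → ℝ) :=
  Set.range (tropMulVec A)

theorem tropMul_le [NeZero n] (A B : Fin n → Fin n → ℝ) (i s j : Fin n) :
    tropMul A B i j ≤ A i s + B s j :=
  Finset.inf'_le (fun s => A i s + B s j) (Finset.mem_univ s)

theorem exists_tropMul_eq [NeZero n] (A B : Fin n → Fin n → ℝ) (i j : Fin n) :
    ∃ s, tropMul A B i j = A i s + B s j := by
  obtain ⟨s, -, hs⟩ := Finset.exists_mem_eq_inf' (Finset.univ_nonempty (α := Fin n))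
    (fun s => A i s + B s j)
  exact ⟨s, hs⟩

theorem tropMulVec_le [NeZero n] (A : Fin n → Fin n → ℝ) (x : Fin n → ℝ) (i j : Fin n) :
    tropMulVec A x i ≤ A i j + x j :=
  Finset.inf'_le (fun j => A i j + x j) (Finset.mem_univ j)

theorem exists_tropMulVec_eq [NeZero n] (A : Fin n → Fin n → ℝ) (x : Fin n → ℝ) (i : Fin n) :
    ∃ j, tropMulVec A x i = A i j + x j := by
  obtain ⟨j, -, hj⟩ := Finset.exists_mem_eq_inf' (Finset.univ_nonempty (α := Fin n))
    (fun j => A i j + x j)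
  exact ⟨j, hj⟩

theorem kleene_le [NeZero n] (A : Fin n → Fin n → ℝ) (i j : Fin n) (k : Fin n) :
    kleene A i j ≤ tropPow A (k.val + 1) i j :=
  Finset.inf'_le (fun k : Fin n => tropPow A (k.val + 1) i j) (Finset.mem_univ k)

theorem exists_kleene_eq [NeZero n] (A : Fin n → Fin n → ℝ) (i j : Fin n) :
    ∃ k : Fin n, kleene A i j = tropPow A (k.val + 1) i j := by
  obtain ⟨k, -, hk⟩ := Finset.exists_mem_eq_inf' (Finset.univ_nonempty (α := Fin n))
    (fun k : Fin n => tropPow A (k.val + 1) i j)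
  exact ⟨k, hk⟩

theorem IsPremetric.nonneg {A : Fin n → Fin n → ℝ} (hA : IsPremetric A) (i j : Fin n) :
    0 ≤ A i j := by
  rcases eq_or_ne i j with rfl | h
  · exact (hA.1 i).ge
  · exact (hA.2 i j h).le

theorem IsPremetric.tropMul [NeZero n] {A B : Fin n → Fin n → ℝ} (hA : IsPremetric A)
    (hB : IsPremetric B) : IsPremetric (tropMul A B) := by
  constructor
  · intro i
    apply le_antisymm
    · have h := tropMul_le A B i i i
      rwa [hA.1, hB.1, add_zero] at h
    · obtain ⟨s, hs⟩ := exists_tropMul_eq A B i i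
      rw [hs]
      exact add_nonneg (hA.nonneg i s) (hB.nonneg s i)
  · intro i j hij
    obtain ⟨s, hs⟩ := exists_tropMul_eq A B i j
    rw [hs]
    rcases eq_or_ne i s with rfl | h
    · exact add_pos_of_nonneg_of_pos (hA.nonneg i i) (hB.2 i j hij)
    · exact add_pos_of_pos_of_nonneg (hA.2 i s h) (hB.nonneg s j)

theorem IsPremetric.tropSum {A B : Fin n → Fin n → ℝ} (hA : IsPremetric A)
    (hB : IsPremetric B) : IsPremetric (tropSum A B) :=
  ⟨fun i => by simp [TropComm.tropSum, hA.1, hB.1],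
    fun i j hij => lt_min (hA.2 i j hij) (hB.2 i j hij)⟩

theorem tropPow_add_two_le [NeZero n] {A : Fin n → Fin n → ℝ} (hA : IsPremetric A)
    (m : ℕ) (i j : Fin n) : tropPow A (m + 2) i j ≤ tropPow A (m + 1) i j := by
  have h := tropMul_le A (tropPow A (m + 1)) i i j
  rwa [hA.1, zero_add] at h

/-- A strict decrease between consecutive tropical powers forces many vertices to be at least as
close to `j` as `i` is. -/
theorem le_card_filter_tropPow_le [NeZero n] {A : Fin n → Fin n → ℝ} (hA : IsPremetric A)
    (j : Fin n) (m : ℕ) : ∀ i, tropPow A (m + 2) i j < tropPow A (m + 1) i j →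
      m + 2 ≤ (Finset.univ.filter
        fun l => tropPow A (m + 2) l j ≤ tropPow A (m + 2) i j).card := by
  induction m with
  | zero =>
    intro i hi
    obtain ⟨k, hk⟩ := exists_tropMul_eq A (tropPow A 1) i j
    change tropPow A 2 i j = A i k + tropPow A 1 k j at hk
    have hki : k ≠ i := by
      rintro rfl
      rw [hA.1, zero_add] at hk
      exact hi.ne hk
    have hle : tropPow A 2 k j ≤ tropPow A 2 i j := by
      have h : tropPow A 2 k j ≤ tropPow A 1 k j := tropPow_add_two_le hA 0 k j
      linarith [hA.nonneg i k]
    refine (Finset.card_pair hki).ge.trans (Finset.card_le_card fun l hl => ?_)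
    rcases Finset.mem_insert.1 hl with rfl | hl
    · simpa using hle
    · simp [Finset.mem_singleton.1 hl]
  | succ m ih =>
    intro i hi
    obtain ⟨k, hk⟩ := exists_tropMul_eq A (tropPow A (m + 2)) i j
    change tropPow A (m + 3) i j = A i k + tropPow A (m + 2) k j at hk
    change tropPow A (m + 3) i j < tropPow A (m + 2) i j at hi
    have hki : i ≠ k := by
      rintro rfl
      rw [hA.1, zero_add] at hk
      exact hi.ne hk
    have hstep : tropPow A (m + 2) i j ≤ A i k + tropPow A (m + 1) k j :=
      tropMul_le A (tropPow A (m + 1)) i k j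
    have hpos := hA.2 i k hki
    refine (Nat.succ_le_succ (ih k (by linarith))).trans
      (Nat.succ_le_of_lt (Finset.card_lt_card ?_))
    rw [Finset.ssubset_iff_of_subset]
    · exact ⟨i, by simp, by simp; linarith⟩
    · intro l hl
      simp only [Finset.mem_filter, Finset.mem_univ, true_and] at hl ⊢
      have : tropPow A (m + 3) l j ≤ tropPow A (m + 2) l j := tropPow_add_two_le hA (m + 1) l j
      change tropPow A (m + 3) l j ≤ tropPow A (m + 3) i j
      linarith

theorem tropPow_le_succ_of_card_le [NeZero n] {A : Fin n → Fin n → ℝ} (hA : IsPremetric A)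
    {m : ℕ} (hm : n ≤ m + 1) (i j : Fin n) : tropPow A (m + 1) i j ≤ tropPow A (m + 2) i j := by
  by_contra! h
  have h1 := le_card_filter_tropPow_le hA j m i h
  have h2 := h1.trans (Finset.card_le_univ _)
  rw [Fintype.card_fin] at h2
  omega

theorem kleene_le_add [NeZero n] {A : Fin n → Fin n → ℝ} (hA : IsPremetric A) (i k j : Fin n) :
    kleene A i j ≤ A i k + kleene A k j := by
  obtain ⟨m, hm⟩ := exists_kleene_eq A k j
  rw [hm]
  have hstep : tropPow A (m.val + 2) i j ≤ A i k + tropPow A (m.val + 1) k j :=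
    tropMul_le A (tropPow A (m.val + 1)) i k j
  refine le_trans ?_ hstep
  by_cases h : m.val + 1 < n
  · exact kleene_le A i j ⟨m.val + 1, h⟩
  · exact (kleene_le A i j m).trans (tropPow_le_succ_of_card_le hA (by omega) i j)

theorem le_tropPow_add [NeZero n] {A : Fin n → Fin n → ℝ} {x : Fin n → ℝ}
    (hx : ∀ i j, x i ≤ A i j + x j) (m : ℕ) (i j : Fin n) :
    x i ≤ tropPow A (m + 1) i j + x j := by
  induction m generalizing i with
  | zero => exact hx i j
  | succ m ih =>
    obtain ⟨k, hk⟩ := exists_tropMul_eq A (tropPow A (m + 1)) i j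
    change tropPow A (m + 2) i j = _ at hk
    change x i ≤ tropPow A (m + 2) i j + x j
    linarith [hx i k, ih k]

/-- The image of the Kleene star of a premetric is its set of tropical subeigenvectors. -/
theorem mem_tropIm_kleene_iff [NeZero n] {A : Fin n → Fin n → ℝ} (hA : IsPremetric A)
    (x : Fin n → ℝ) : x ∈ tropIm (kleene A) ↔ ∀ i j, x i ≤ A i j + x j := by
  constructor
  · rintro ⟨y, rfl⟩ i j
    obtain ⟨k, hk⟩ := exists_tropMulVec_eq (kleene A) y j
    linarith [tropMulVec_le (kleene A) y i k, kleene_le_add hA i j k]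
  · intro hx
    refine ⟨x, funext fun i => le_antisymm ?_ ?_⟩
    · have h0 : kleene A i i ≤ A i i := kleene_le A i i 0
      linarith [tropMulVec_le (kleene A) x i i, hA.1 i]
    · obtain ⟨j, hj⟩ := exists_tropMulVec_eq (kleene A) x i
      obtain ⟨m, hm⟩ := exists_kleene_eq A i j
      rw [hj, hm]
      exact le_tropPow_add hx m i j

/-- If `A, B` are premetrics, then
`im((A ⊙ B)*) = im((A ⊕ B)*) = im(A*) ∩ im(B*)`. -/
theorem stmt9 {n : ℕ} [NeZero n] (A B : Fin n → Fin n → ℝ)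
    (hA : IsPremetric A) (hB : IsPremetric B) :
    tropIm (kleene (tropMul A B)) = tropIm (kleene (tropSum A B)) ∧
    tropIm (kleene (tropSum A B)) = tropIm (kleene A) ∩ tropIm (kleene B) := by
  have hsum : ∀ x : Fin n → ℝ, (∀ i j, x i ≤ tropSum A B i j + x j) ↔
      (∀ i j, x i ≤ A i j + x j) ∧ ∀ i j, x i ≤ B i j + x j := by
    intro x
    simp only [tropSum, min_add, le_min_iff, forall_and]
  constructor
  · ext x
    rw [mem_tropIm_kleene_iff (hA.tropMul hB), mem_tropIm_kleene_iff (hA.tropSum hB), hsum]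
    constructor
    · intro h
      refine ⟨fun i j => ?_, fun i j => ?_⟩
      · linarith [h i j, tropMul_le A B i j j, hB.1 j]
      · linarith [h i j, tropMul_le A B i i j, hA.1 i]
    · rintro ⟨h₁, h₂⟩ i j
      obtain ⟨s, hs⟩ := exists_tropMul_eq A B i j
      linarith [h₁ i s, h₂ s j]
  · ext x
    rw [Set.mem_inter_iff, mem_tropIm_kleene_iff (hA.tropSum hB), mem_tropIm_kleene_iff hA,
      mem_tropIm_kleene_iff hB, hsum]

end TropComm
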